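/- For every integer d ≥ 2 there exist a real constant α_d > 0 and an integer C'_d such that for every integer k ≥ 2 there is a set P ⊆ ℝ^d of k points with q_d(P) ≤ α_d · k^{1/d} and P is C'_d-hole-free. -/

import Mathlib

noncomputable section

/-- A finite set `S ⊆ ℝ^d` is `ℓ`-hole-free if for every `ℓ` distinct points of `S` there is a
point of `S` lying in the interior of the convex hull of those points. -/
def HoleFree {d : ℕ} (ℓ : ℕ) (S : Set (EuclideanSpace ℝ (Fin d))) : Prop :=
  ∀ T : Set (EuclideanSpace ℝ (Fin d)), T ⊆ S → T.Finite → T.ncard = ℓ →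
    ∃ s ∈ S, s ∈ interior (convexHull ℝ T)

/-- The spread of a finite point set: the maximum distance between two distinct points divided
by the minimum distance between two distinct points. -/
def spread {d : ℕ} (P : Set (EuclideanSpace ℝ (Fin d))) : ℝ :=
  sSup {c : ℝ | ∃ x ∈ P, ∃ y ∈ P, x ≠ y ∧ c = dist x y} /
    sInf {c : ℝ | ∃ x ∈ P, ∃ y ∈ P, x ≠ y ∧ c = dist x y}

namespace HF
open Filter Topology Finset

def dirSub {ι E : Type*} [AddCommGroup E] [Module ℝ E] (S : Finset ι) (q : ι → E) :
    Submodule ℝ E where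
  carrier := {v | ∃ γ : ι → ℝ, ∑ x ∈ S, γ x = 0 ∧ ∑ x ∈ S, γ x • q x = v}
  add_mem' := by
    rintro a b ⟨f, hf, rfl⟩ ⟨g, hg, rfl⟩
    refine ⟨fun x => f x + g x, ?_, ?_⟩
    · rw [Finset.sum_add_distrib, hf, hg, add_zero]
    · simp only [add_smul, Finset.sum_add_distrib]
  zero_mem' := ⟨fun _ => 0, by simp, by simp⟩
  smul_mem' := by
    rintro c a ⟨f, hf, rfl⟩
    refine ⟨fun x => c * f x, ?_, ?_⟩
    · rw [← Finset.mul_sum, hf, mul_zero]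
    · simp only [mul_smul, Finset.smul_sum]

lemma mem_dirSub {ι E : Type*} [AddCommGroup E] [Module ℝ E] {S : Finset ι} {q : ι → E} {v : E} :
    v ∈ dirSub S q ↔ ∃ γ : ι → ℝ, ∑ x ∈ S, γ x = 0 ∧ ∑ x ∈ S, γ x • q x = v := Iff.rfl

lemma dirSub_mono {ι E : Type*} [DecidableEq ι] [AddCommGroup E] [Module ℝ E] {S T : Finset ι}
    (h : S ⊆ T) (q : ι → E) : dirSub S q ≤ dirSub T q := by
  rintro v ⟨γ, h0, h1⟩
  refine ⟨fun x => if x ∈ S then γ x else 0, ?_, ?_⟩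
  · show ∑ x ∈ T, (if x ∈ S then γ x else 0) = 0
    rw [Finset.sum_ite_mem, Finset.inter_eq_right.mpr h, h0]
  · rw [← h1]
    simp only [ite_smul, zero_smul]
    rw [Finset.sum_ite_mem, Finset.inter_eq_right.mpr h]

lemma sub_mem_dirSub {ι E : Type*} [DecidableEq ι] [AddCommGroup E] [Module ℝ E] {S : Finset ι}
    (q : ι → E) {x y : ι} (hx : x ∈ S) (hy : y ∈ S) : q x - q y ∈ dirSub S q := by
  refine ⟨fun u => (if u = x then 1 else 0) - (if u = y then 1 else 0), ?_, ?_⟩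
  · simp [Finset.sum_sub_distrib, hx, hy]
  · simp [sub_smul, Finset.sum_sub_distrib, hx, hy]

lemma step {ι E : Type*} [DecidableEq ι] [AddCommGroup E] [Module ℝ E] (S : Finset ι)
    (y z : ι) (hy : y ∉ S) (q : ι → E) (e : E) (h : ι → ℝ) (lam bet : ι → ℝ) (mu : ℝ)
    (hl1 : ∑ x ∈ S, lam x = 1) (hlz : ∑ x ∈ S, lam x • q x = q z)
    (hb1 : ∑ x ∈ S, bet x = 1) (hby : ∑ x ∈ S, bet x • q x = q y)
    (hmu : mu * (h y - ∑ x ∈ S, bet x * h x) = h z - ∑ x ∈ S, lam x * h x)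
    (hpos : ∀ x ∈ S, 0 < lam x - mu * bet x) (hmu0 : 0 < mu)
    (hne : h y - ∑ x ∈ S, bet x * h x ≠ 0) :
    (∃ lam' : ι → ℝ, (∀ x ∈ insert y S, 0 < lam' x) ∧ ∑ x ∈ insert y S, lam' x = 1 ∧
      ∑ x ∈ insert y S, lam' x • (q x + h x • e) = q z + h z • e) ∧
    e ∈ dirSub (insert y S) (fun x => q x + h x • e) ∧
    dirSub S q ≤ dirSub (insert y S) (fun x => q x + h x • e) := by
  have hney : ∀ x ∈ S, x ≠ y := fun x hx hxy => hy (hxy ▸ hx)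
  have he : e ∈ dirSub (insert y S) (fun x => q x + h x • e) := by
    have h1 : (h y - ∑ x ∈ S, bet x * h x) • e ∈
        dirSub (insert y S) (fun x => q x + h x • e) := by
      refine ⟨fun x => if x = y then 1 else - bet x, ?_, ?_⟩
      · rw [Finset.sum_insert hy, if_pos rfl,
          Finset.sum_congr rfl (fun x hx => if_neg (hney x hx))]
        rw [Finset.sum_neg_distrib, hb1]; ring
      · rw [Finset.sum_insert hy]
        simp only [if_true]
        rw [Finset.sum_congr rfl (g := fun x => - (bet x • q x) - (bet x * h x) • e)]
        · rw [Finset.sum_sub_distrib, Finset.sum_neg_distrib, hby, ← Finset.sum_smul]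
          module
        · intro x hx
          rw [if_neg (hney x hx)]
          module
    have h2 := (dirSub (insert y S) (fun x => q x + h x • e)).smul_mem
      (h y - ∑ x ∈ S, bet x * h x)⁻¹ h1
    rwa [smul_smul, inv_mul_cancel₀ hne, one_smul] at h2
  refine ⟨⟨fun x => if x = y then mu else lam x - mu * bet x, ?_, ?_, ?_⟩, he, ?_⟩
  · intro x hx
    rcases Finset.mem_insert.mp hx with rfl | hx
    · simpa using hmu0
    · simpa [hney x hx] using hpos x hx
  · rw [Finset.sum_insert hy, if_pos rfl,
      Finset.sum_congr rfl (fun x hx => if_neg (hney x hx))]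
    rw [Finset.sum_sub_distrib, ← Finset.mul_sum, hb1, hl1]; ring
  · rw [Finset.sum_insert hy]
    simp only [if_true]
    rw [Finset.sum_congr rfl (g := fun x => lam x • q x - mu • (bet x • q x) +
      ((lam x * h x) • e - mu • ((bet x * h x) • e)))]
    · rw [Finset.sum_add_distrib, Finset.sum_sub_distrib, Finset.sum_sub_distrib,
        ← Finset.smul_sum, ← Finset.smul_sum, hby, hlz, ← Finset.sum_smul, ← Finset.sum_smul]
      have : h z = mu * (h y - ∑ x ∈ S, bet x * h x) + ∑ x ∈ S, lam x * h x := by linarith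
      rw [this]
      module
    · intro x hx
      rw [if_neg (hney x hx)]
      module
  · rintro v ⟨γ, h0, h1⟩
    have h3 : ∑ x ∈ S, γ x • (q x + h x • e) ∈
        dirSub (insert y S) (fun x => q x + h x • e) :=
      dirSub_mono (Finset.subset_insert y S) _ ⟨γ, h0, rfl⟩
    have h4 : v = ∑ x ∈ S, γ x • (q x + h x • e) - (∑ x ∈ S, γ x * h x) • e := by
      simp only [smul_add, Finset.sum_add_distrib, h1, Finset.sum_smul, mul_smul]
      abel
    rw [h4]
    exact Submodule.sub_mem _ h3 (Submodule.smul_mem _ _ he)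

def dig (p i t : ℕ) : ℕ := t / p ^ i % p

def hor (p L : ℕ) (ε : ℝ) (t : ℕ) : ℝ := ∑ i ∈ range L, ε ^ (i + 1) * (dig p i t : ℝ)

lemma modEq_succ {p i s t : ℕ} :
    s ≡ t [MOD p ^ (i + 1)] ↔ s ≡ t [MOD p ^ i] ∧ dig p i s = dig p i t := by
  constructor
  · intro h
    refine ⟨h.of_dvd (pow_dvd_pow p (Nat.le_succ i)), ?_⟩
    unfold dig
    rw [← Nat.mod_mul_right_div_self, ← Nat.mod_mul_right_div_self, ← pow_succ, h]
  · rintro ⟨h1, h2⟩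
    unfold Nat.ModEq dig at *
    rw [Nat.mod_pow_succ, Nat.mod_pow_succ, h1, h2]

lemma dig_eq_of_lt {p i k s t : ℕ} (hk : k < i) (h : s ≡ t [MOD p ^ i]) :
    dig p k s = dig p k t :=
  (modEq_succ.mp (h.of_dvd (pow_dvd_pow p hk))).2

lemma hor_tendsto {p L i s t : ℕ} (hi : i < L) (h : s ≡ t [MOD p ^ i]) :
    Tendsto (fun ε : ℝ => (hor p L ε s - hor p L ε t) / ε ^ (i + 1)) (𝓝[>] 0)
      (𝓝 ((dig p i s : ℝ) - dig p i t)) := by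
  have h1 : ∀ ε : ℝ, (hor p L ε s - hor p L ε t) / ε ^ (i + 1) =
      ∑ k ∈ range L, ε ^ (k + 1) / ε ^ (i + 1) * ((dig p k s : ℝ) - dig p k t) := by
    intro ε
    unfold hor
    rw [← Finset.sum_sub_distrib, Finset.sum_div]
    refine Finset.sum_congr rfl fun k _ => by ring
  simp only [h1]
  have h2 : ((dig p i s : ℝ) - dig p i t) =
      ∑ k ∈ range L, if k = i then ((dig p i s : ℝ) - dig p i t) else 0 := by
    simp [hi]
  rw [h2]
  refine tendsto_finsetSum _ fun k _ => ?_
  rcases lt_trichotomy k i with hk | hk | hk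
  · rw [dig_eq_of_lt hk h, if_neg hk.ne]
    simp
  · subst hk
    rw [if_pos rfl]
    refine tendsto_const_nhds.congr' ?_
    filter_upwards [self_mem_nhdsWithin] with ε hε
    have : ε ≠ 0 := ne_of_gt hε
    field_simp
  · rw [if_neg hk.ne']
    have h3 : Tendsto (fun ε : ℝ => ε ^ (k - i) * ((dig p k s : ℝ) - dig p k t)) (𝓝[>] 0)
        (𝓝 0) := by
      have : Continuous (fun ε : ℝ => ε ^ (k - i) * ((dig p k s : ℝ) - dig p k t)) := by
        fun_prop
      have h4 := this.tendsto 0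
      rw [zero_pow (by omega), zero_mul] at h4
      exact h4.mono_left nhdsWithin_le_nhds
    refine h3.congr' ?_
    filter_upwards [self_mem_nhdsWithin] with ε hε
    have : ε ≠ 0 := ne_of_gt hε
    have h5 : ε ^ (k + 1) = ε ^ (k - i) * ε ^ (i + 1) := by
      rw [← pow_add]; congr 1; omega
    rw [h5]
    field_simp

def StepOK {ι : Type*} (p L : ℕ) (t : ι → ℕ) (S : Finset ι) (y z : ι) : Prop :=
  ∃ i i' c : ℕ, i < i' ∧ i' < L ∧ (∀ x ∈ S, t x ≡ t y [MOD p ^ i]) ∧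
    (∀ x ∈ S, dig p i (t x) = c) ∧ dig p i (t y) ≠ c ∧
    (∀ x ∈ S, t x ≡ t z [MOD p ^ i']) ∧
    (∀ x ∈ S, 0 ≤ ((dig p i (t y) : ℝ) - c) * ((dig p i' (t z) : ℝ) - dig p i' (t x))) ∧
    ∃ x ∈ S, 0 < ((dig p i (t y) : ℝ) - c) * ((dig p i' (t z) : ℝ) - dig p i' (t x))

lemma stepOK_ev {ι : Type*} {p L : ℕ} {t : ι → ℕ} {S : Finset ι} {y z : ι}
    (hok : StepOK p L t S y z) (lam bet : ι → ℝ) (hlp : ∀ x ∈ S, 0 < lam x)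
    (hl1 : ∑ x ∈ S, lam x = 1) (hb1 : ∑ x ∈ S, bet x = 1) :
    ∀ᶠ ε in 𝓝[>] (0 : ℝ), hor p L ε (t y) - ∑ x ∈ S, bet x * hor p L ε (t x) ≠ 0 ∧
      ∃ mu : ℝ, 0 < mu ∧ mu * (hor p L ε (t y) - ∑ x ∈ S, bet x * hor p L ε (t x)) =
        hor p L ε (t z) - ∑ x ∈ S, lam x * hor p L ε (t x) ∧
        ∀ x ∈ S, 0 < lam x - mu * bet x := by
  obtain ⟨i, i', c, hii, hiL, h1, h2, h3, h4, h5, x1, hx1, h6⟩ := hok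
  set m : ℝ := (dig p i (t y) : ℝ) - c with hm
  have hm0 : m ≠ 0 := by
    rw [hm, sub_ne_zero]; exact_mod_cast h3
  set s : ℝ := ∑ x ∈ S, lam x * ((dig p i' (t z) : ℝ) - dig p i' (t x)) with hs
  have hms : 0 < m * s := by
    rw [hs, Finset.mul_sum]
    refine Finset.sum_pos' (fun x hx => ?_) ⟨x1, hx1, ?_⟩
    · have := mul_nonneg (hlp x hx).le (h5 x hx)
      linarith [this]
    · have := mul_pos (hlp x1 hx1) h6
      linarith [this]
  have key : ∀ (w : ι → ℝ) (u : ι) (l : ℕ), l < L → (∑ x ∈ S, w x = 1) →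
      (∀ x ∈ S, t x ≡ t u [MOD p ^ l]) →
      Tendsto (fun ε : ℝ => (hor p L ε (t u) - ∑ x ∈ S, w x * hor p L ε (t x)) / ε ^ (l + 1))
        (𝓝[>] 0) (𝓝 (∑ x ∈ S, w x * ((dig p l (t u) : ℝ) - dig p l (t x)))) := by
    intro w u l hl hw hc
    have e1 : ∀ ε : ℝ, (hor p L ε (t u) - ∑ x ∈ S, w x * hor p L ε (t x)) / ε ^ (l + 1) =
        ∑ x ∈ S, w x * ((hor p L ε (t u) - hor p L ε (t x)) / ε ^ (l + 1)) := by
      intro ε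
      have : hor p L ε (t u) = ∑ x ∈ S, w x * hor p L ε (t u) := by
        rw [← Finset.sum_mul, hw, one_mul]
      conv_lhs => rw [this]
      rw [← Finset.sum_sub_distrib, Finset.sum_div]
      refine Finset.sum_congr rfl fun x _ => by ring
    simp only [e1]
    exact tendsto_finsetSum _ fun x hx =>
      (hor_tendsto hl (hc x hx).symm).const_mul _
  have kA := key bet y i (by omega) hb1 h1
  have kE := key lam z i' hiL hl1 h4
  have hmA : ∑ x ∈ S, bet x * ((dig p i (t y) : ℝ) - dig p i (t x)) = m := by
    rw [Finset.sum_congr rfl (g := fun x => bet x * m), ← Finset.sum_mul, hb1, one_mul]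
    intro x hx
    rw [h2 x hx]
  rw [hmA] at kA
  rw [← hs] at kE
  have kQ := kE.div kA hm0
  have hsm : 0 < s / m := by
    have : s / m = m * s / (m * m) := by field_simp
    rw [this]; exact div_pos hms (mul_self_pos.mpr hm0)
  have kP : Tendsto (fun ε : ℝ => ε ^ (i' - i)) (𝓝[>] 0) (𝓝 0) := by
    have h := (continuous_pow (M := ℝ) (i' - i)).tendsto 0
    rw [zero_pow (by omega)] at h
    exact h.mono_left nhdsWithin_le_nhds
  have kM := kQ.mul kP
  rw [mul_zero] at kM
  have kL : ∀ᶠ ε in 𝓝[>] (0 : ℝ), ∀ x ∈ S, 0 < lam x -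
      ((hor p L ε (t z) - ∑ x ∈ S, lam x * hor p L ε (t x)) / ε ^ (i' + 1) /
        ((hor p L ε (t y) - ∑ x ∈ S, bet x * hor p L ε (t x)) / ε ^ (i + 1)) * ε ^ (i' - i))
        * bet x := by
    rw [Filter.eventually_all_finset]
    intro x hx
    have h := (kM.mul_const (bet x)).const_sub (lam x)
    rw [zero_mul, sub_zero] at h
    exact h.eventually (lt_mem_nhds (hlp x hx))
  filter_upwards [kL, kA.eventually_ne hm0, kQ.eventually (lt_mem_nhds hsm),
    self_mem_nhdsWithin] with ε e1 e2 e3 e4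
  have e4' : 0 < ε := e4
  have hA : hor p L ε (t y) - ∑ x ∈ S, bet x * hor p L ε (t x) ≠ 0 := by
    intro h; rw [h, zero_div] at e2; exact e2 rfl
  refine ⟨hA, _, mul_pos e3 (pow_pos e4' _), ?_, e1⟩
  have e5 : ε ^ (i' + 1) = ε ^ (i' - i) * ε ^ (i + 1) := by
    rw [← pow_add]; congr 1; omega
  simp only [Pi.div_apply]
  rw [e5]
  field_simp

lemma interior_of_pos {d : ℕ} {ι : Type*} (S : Finset ι) (q : ι → EuclideanSpace ℝ (Fin d))
    (lam : ι → ℝ) (hp : ∀ x ∈ S, 0 < lam x) (h1 : ∑ x ∈ S, lam x = 1)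
    (hd : ∀ b, EuclideanSpace.single b (1 : ℝ) ∈ dirSub S q) :
    ∑ x ∈ S, lam x • q x ∈ interior (convexHull ℝ (q '' S)) := by
  rw [mem_interior_iff_mem_nhds]
  choose γ h0 hγ using hd
  set c := ∑ x ∈ S, lam x • q x with hc
  have hev : ∀ᶠ v in 𝓝 c, ∀ x ∈ S, 0 < lam x + ∑ b, (v b - c b) * γ b x := by
    rw [Filter.eventually_all_finset]
    intro x hx
    have hcont : Continuous (fun v : EuclideanSpace ℝ (Fin d) =>
        lam x + ∑ b, (v b - c b) * γ b x) := by fun_prop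
    have := hcont.tendsto c
    simp only [sub_self, zero_mul, Finset.sum_const_zero, add_zero] at this
    exact this.eventually (lt_mem_nhds (hp x hx))
  filter_upwards [hev] with v hv
  have hsum : ∑ x ∈ S, (lam x + ∑ b, (v b - c b) * γ b x) = 1 := by
    rw [Finset.sum_add_distrib, h1, Finset.sum_comm]
    simp [← Finset.mul_sum, h0]
  have hval : ∑ x ∈ S, (lam x + ∑ b, (v b - c b) * γ b x) • q x = v := by
    simp only [add_smul, Finset.sum_add_distrib, Finset.sum_smul]
    rw [Finset.sum_comm, ← hc]
    simp only [mul_smul, ← Finset.smul_sum, hγ]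
    ext j
    simp [Pi.single_apply]
  rw [← hval]
  exact (convex_convexHull ℝ _).sum_mem (fun x hx => (hv x hx).le) hsum
    (fun x hx => subset_convexHull ℝ _ ⟨x, hx, rfl⟩)


lemma firstSplit {ι : Type*} {p L : ℕ} (hp : 2 ≤ p) (t : ι → ℕ) (ht : ∀ x, t x < 2 ^ L)
    (S : Finset ι) {x x' : ι} (hx : x ∈ S) (hx' : x' ∈ S) (hne : t x ≠ t x') :
    ∃ i < L, (∀ u ∈ S, ∀ v ∈ S, t u ≡ t v [MOD p ^ i]) ∧
      ∃ u ∈ S, ∃ v ∈ S, dig p i (t u) ≠ dig p i (t v) := by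
  classical
  have hlt : ∀ x, t x < p ^ L := fun x => (ht x).trans_le (Nat.pow_le_pow_left hp L)
  have hL : ∃ i, ∃ u ∈ S, ∃ v ∈ S, ¬ t u ≡ t v [MOD p ^ i] := by
    refine ⟨L, x, hx, x', hx', fun h => hne ?_⟩
    exact h.eq_of_lt_of_lt (hlt x) (hlt x')
  obtain ⟨u, hu, v, hv, huv⟩ := Nat.find_spec hL
  have hle : Nat.find hL ≤ L := by
    refine Nat.find_min' hL ⟨x, hx, x', hx', fun h => hne ?_⟩
    exact h.eq_of_lt_of_lt (hlt x) (hlt x')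
  have hmin := fun m => @Nat.find_min _ _ hL m
  generalize Nat.find hL = k at *
  cases k with
  | zero => exact absurd (by simp [Nat.ModEq, Nat.mod_one]) huv
  | succ i =>
    have h := hmin i (Nat.lt_succ_self i)
    push Not at h
    refine ⟨i, by omega, h, u, hu, v, hv, fun hd => huv ?_⟩
    exact modEq_succ.mpr ⟨h u hu v hv, hd⟩

lemma chain {ι : Type*} [DecidableEq ι] {L : ℕ} (p : ℕ → ℕ) (hp : ∀ a, 2 ≤ p a) (t : ι → ℕ)
    (ht : ∀ x, t x < 2 ^ L) (hinj : Function.Injective t) (s : ℕ) (hs : 2 ≤ s) :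
    ∀ (m : ℕ) (Y : Finset ι), s * ∏ a ∈ range m, p a ≤ Y.card →
      ∃ X0 ⊆ Y, X0.card = s ∧ ∃ y : ℕ → ι, (∀ a < m, y a ∈ Y) ∧
        ∀ a < m, ∃ i < L, ∃ c : ℕ, (∀ x ∈ X0 ∪ (range a).image y,
          t x ≡ t (y a) [MOD p a ^ i] ∧ dig (p a) i (t x) = c) ∧ dig (p a) i (t (y a)) ≠ c := by
  intro m
  induction m with
  | zero =>
    intro Y hY
    simp only [range_zero, prod_empty, mul_one] at hY
    obtain ⟨X0, h1, h2⟩ := Finset.exists_subset_card_eq hY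
    obtain ⟨x, -⟩ := Finset.card_pos.mp (show 0 < X0.card by omega)
    exact ⟨X0, h1, h2, fun _ => x, by simp, by simp⟩
  | succ m ih =>
    intro Y hY
    rw [prod_range_succ] at hY
    set N := s * ∏ a ∈ range m, p a with hN
    have hprod : 1 ≤ ∏ a ∈ range m, p a :=
      Nat.succ_le_of_lt (Finset.prod_pos (fun a _ => lt_of_lt_of_le Nat.zero_lt_two (hp a)))
    have hN2 : 2 ≤ N := by nlinarith
    have hYc : N * p m ≤ Y.card := by rw [hN]; linarith
    have h1 : 1 < Y.card := by have := hp m; nlinarith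
    obtain ⟨x, hx, x', hx', hne⟩ := Finset.one_lt_card.mp h1
    obtain ⟨i, hi, hc, u, hu, v, hv, huv⟩ :=
      firstSplit (hp m) t ht Y hx hx' (fun h => hne (hinj h))
    obtain ⟨c, hcm, hcard⟩ := Finset.exists_le_card_fiber_of_mul_le_card_of_maps_to
      (s := Y) (t := range (p m)) (f := fun x => dig (p m) i (t x)) (n := N)
      (fun a _ => Finset.mem_range.mpr (Nat.mod_lt _ (by have := hp m; omega)))
      (⟨0, Finset.mem_range.mpr (by have := hp m; omega)⟩)
      (by rw [Finset.card_range]; linarith)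
    obtain ⟨w, hw, hwc⟩ : ∃ w ∈ Y, dig (p m) i (t w) ≠ c := by
      by_contra! hcon
      exact huv ((hcon u hu).trans (hcon v hv).symm)
    obtain ⟨X0, hX0, hX0c, y, hy, hya⟩ := ih _ hcard
    refine ⟨X0, hX0.trans (Finset.filter_subset _ _), hX0c, Function.update y m w, ?_, ?_⟩
    · intro a ha
      by_cases ham : a = m
      · subst ham; simpa using hw
      · rw [Function.update_of_ne ham]
        exact (Finset.mem_filter.mp (hy a (by omega))).1
    · intro a ha
      have him : (range a).image (Function.update y m w) = (range a).image y := by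
        refine Finset.image_congr fun b hb => ?_
        have : b < a := by simpa using hb
        rw [Function.update_of_ne (by omega)]
      rw [him]
      by_cases ham : a = m
      · subst ham
        refine ⟨i, hi, c, ?_, by simpa using hwc⟩
        intro x hx
        have hxY : x ∈ Y.filter (fun x => dig (p a) i (t x) = c) := by
          rcases Finset.mem_union.mp hx with h | h
          · exact hX0 h
          · obtain ⟨b, hb, rfl⟩ := Finset.mem_image.mp h
            exact hy b (by simpa using hb)
        rw [Finset.mem_filter] at hxY
        simp only [Function.update_self]
        exact ⟨hc x hxY.1 w hw, hxY.2⟩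
      · rw [Function.update_of_ne ham]
        exact hya a (by omega)

lemma crt {d : ℕ} (M : Fin d → ℕ) (hM : ∀ a b, a ≠ b → Nat.Coprime (M a) (M b)) :
    ∃ c : Fin d → ℤ, ∀ a b, (M b : ℤ) ∣ c a - (if a = b then 1 else 0) := by
  have : ∀ a, ∃ c : ℤ, ∀ b, (M b : ℤ) ∣ c - (if a = b then 1 else 0) := by
    intro a
    have hcop : IsCoprime (M a : ℤ) (∏ b ∈ univ.erase a, (M b : ℤ)) := by
      refine IsCoprime.prod_right fun b hb => ?_
      exact Nat.isCoprime_iff_coprime.mpr (hM a b (Finset.ne_of_mem_erase hb).symm)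
    obtain ⟨u, v, huv⟩ := hcop
    refine ⟨v * ∏ b ∈ univ.erase a, (M b : ℤ), fun b => ?_⟩
    by_cases hab : a = b
    · subst hab
      rw [if_pos rfl]
      exact ⟨-u, by linarith⟩
    · rw [if_neg hab, sub_zero]
      exact Dvd.dvd.mul_left (Finset.dvd_prod_of_mem (fun b => (M b : ℤ))
        (Finset.mem_erase.mpr ⟨fun h => hab h.symm, Finset.mem_univ b⟩)) v
  choose c hc using this
  exact ⟨c, hc⟩

abbrev Pt (d n : ℕ) := Fin d → Fin n

def emb {d : ℕ} (v : Fin d → ℤ) : EuclideanSpace ℝ (Fin d) := WithLp.toLp 2 (fun i => (v i : ℝ))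

def toZ {d n : ℕ} (x : Pt d n) : Fin d → ℤ := fun i => ((x i : ℕ) : ℤ)

def q0 {d n : ℕ} (x : Pt d n) : EuclideanSpace ℝ (Fin d) := emb (toZ x)

def TT {d : ℕ} (n : ℕ) (v : Fin d → ℤ) : ℤ := ∑ i, v i * (n : ℤ) ^ (i : ℕ)

def tau {d n : ℕ} (x : Pt d n) : ℕ := (finFunctionFinEquiv x : Fin (n ^ d))

lemma tau_TT {d n : ℕ} (x : Pt d n) : (tau x : ℤ) = TT n (toZ x) := by
  unfold tau TT toZ
  rw [finFunctionFinEquiv_apply]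
  push_cast
  rfl

lemma tau_inj {d n : ℕ} : Function.Injective (tau : Pt d n → ℕ) := by
  intro x y h
  exact finFunctionFinEquiv.injective (Fin.ext h)

lemma tau_lt {d n : ℕ} (x : Pt d n) : tau x < 2 ^ (n ^ d) :=
  (Fin.isLt _).trans Nat.lt_two_pow_self

lemma TT_add {d n : ℕ} (u v : Fin d → ℤ) : TT n (u + v) = TT n u + TT n v := by
  simp [TT, add_mul, Finset.sum_add_distrib]

lemma TT_sub {d n : ℕ} (u v : Fin d → ℤ) : TT n (u - v) = TT n u - TT n v := by
  simp [TT, sub_mul, Finset.sum_sub_distrib]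

lemma TT_smul {d n : ℕ} (c : ℤ) (v : Fin d → ℤ) : TT n (c • v) = c * TT n v := by
  simp [TT, Finset.mul_sum, mul_assoc]

lemma TT_sum {d n : ℕ} {ι : Type*} (S : Finset ι) (v : ι → Fin d → ℤ) :
    TT n (∑ x ∈ S, v x) = ∑ x ∈ S, TT n (v x) := by
  classical
  induction S using Finset.induction_on with
  | empty => simp [TT]
  | insert a S ha ih => rw [Finset.sum_insert ha, Finset.sum_insert ha, TT_add, ih]

lemma emb_add {d : ℕ} (u v : Fin d → ℤ) : emb (u + v) = emb u + emb v := by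
  ext i; simp [emb]

lemma emb_sub {d : ℕ} (u v : Fin d → ℤ) : emb (u - v) = emb u - emb v := by
  ext i; simp [emb]

lemma emb_smul {d : ℕ} (c : ℤ) (v : Fin d → ℤ) : emb (c • v) = (c : ℝ) • emb v := by
  ext i; simp [emb]

lemma emb_sum {d : ℕ} {ι : Type*} (S : Finset ι) (v : ι → Fin d → ℤ) :
    emb (∑ x ∈ S, v x) = ∑ x ∈ S, emb (v x) := by
  classical
  induction S using Finset.induction_on with
  | empty => ext i; simp [emb]
  | insert a S ha ih => rw [Finset.sum_insert ha, Finset.sum_insert ha, emb_add, ih]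

lemma exists_z {d n : ℕ} (X0 : Finset (Pt d n)) (x0 : Pt d n) (hx0 : x0 ∈ X0) (Q D : ℕ)
    (hD : 0 < D) (hQ : X0.card * D < Q)
    (hmod : ∀ x ∈ X0, ∀ i, (Q : ℤ) ∣ toZ x i - toZ x0 i)
    (M : Fin d → ℕ) (hcop : ∀ a, Nat.Coprime Q (M a))
    (hM : ∀ a, ∀ x ∈ X0, (M a : ℤ) ∣ D * (TT n (toZ x) - TT n (toZ x0)))
    (z0 : Fin d → ℤ) (hz0 : emb z0 - q0 x0 ∈ dirSub X0 (q0 : Pt d n → _)) :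
    ∃ z : Pt d n, (∃ lam : Pt d n → ℝ, (∀ x ∈ X0, 0 < lam x) ∧ ∑ x ∈ X0, lam x = 1 ∧
      ∑ x ∈ X0, lam x • q0 x = q0 z) ∧ ∀ a, (M a : ℤ) ∣ TT n (toZ z) - TT n z0 := by
  classical
  obtain ⟨γ, hγ0, hγ1⟩ := hz0
  have hw : ∀ x : Pt d n, ∃ w : Fin d → ℤ, x ∈ X0 → (Q : ℤ) • w = toZ x - toZ x0 := by
    intro x
    by_cases hx : x ∈ X0
    · choose w hw using hmod x hx
      exact ⟨w, fun _ => by ext i; simp [hw i]⟩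
    · exact ⟨0, fun h => absurd h hx⟩
  choose w hw using hw
  have hQ0 : (0 : ℝ) < Q := by
    have : 0 < Q := by omega
    exact_mod_cast this
  have hD0 : (0 : ℝ) < D := by exact_mod_cast hD
  let k : Pt d n → ℤ := fun x => ⌊- γ x * Q / D⌋ + 1
  let mu : Pt d n → ℝ := fun x => γ x + k x * D / Q
  have hmu : ∀ x, 0 < mu x ∧ mu x ≤ D / Q := by
    intro x
    have h1 := Int.floor_le (- γ x * Q / D)
    have h2 := Int.lt_floor_add_one (- γ x * Q / D)
    have hk : (k x : ℝ) = ⌊- γ x * Q / D⌋ + 1 := by simp [k]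
    rw [← hk] at h2
    have h1 : (k x : ℝ) - 1 ≤ - γ x * Q / D := by linarith
    rw [div_lt_iff₀ hD0] at h2
    rw [le_div_iff₀ hD0] at h1
    have e : mu x = (γ x * Q + k x * D) / Q := by simp only [mu]; field_simp
    rw [e]
    constructor
    · apply div_pos _ hQ0; linarith
    · gcongr; linarith
  let zz : Fin d → ℤ := z0 + ∑ x ∈ X0, (k x * D) • w x
  let lam : Pt d n → ℝ := fun x => if x = x0 then 1 - ∑ u ∈ X0.erase x0, mu u else mu x
  have hlam_ne : ∀ x ∈ X0.erase x0, lam x = mu x := fun x hx => if_neg (Finset.ne_of_mem_erase hx)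
  have hlam0 : lam x0 = 1 - ∑ u ∈ X0.erase x0, mu u := if_pos rfl
  have hlampos : ∀ x ∈ X0, 0 < lam x := by
    intro x hx
    by_cases hxx : x = x0
    · rw [hxx, hlam0]
      have h1 : ∑ u ∈ X0.erase x0, mu u ≤ ∑ u ∈ X0.erase x0, (D : ℝ) / Q :=
        Finset.sum_le_sum fun u _ => (hmu u).2
      rw [Finset.sum_const, nsmul_eq_mul] at h1
      have h2 : ((X0.erase x0).card : ℝ) ≤ X0.card := by
        exact_mod_cast Finset.card_le_card (Finset.erase_subset _ _)
      have h3 : (X0.card : ℝ) * D < Q := by exact_mod_cast hQ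
      have h4 : (X0.card : ℝ) * (D / Q) < 1 := by
        rw [← mul_div_assoc, div_lt_one hQ0]; exact h3
      have h5 : ((X0.erase x0).card : ℝ) * (D / Q) ≤ X0.card * (D / Q) := by gcongr
      linarith
    · rw [hlam_ne x (Finset.mem_erase.mpr ⟨hxx, hx⟩)]
      exact (hmu x).1
  have hlamsum : ∑ x ∈ X0, lam x = 1 := by
    rw [← Finset.add_sum_erase _ _ hx0, hlam0, Finset.sum_congr rfl hlam_ne]
    ring
  have hval : ∑ x ∈ X0, lam x • q0 x = emb zz := by
    have hwE : ∀ x ∈ X0, emb (w x) = (1 / (Q : ℝ)) • (q0 x - q0 x0) := by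
      intro x hx
      have := congrArg emb (hw x hx)
      rw [emb_smul, emb_sub] at this
      change _ = q0 x - q0 x0 at this
      rw [← this, smul_smul]
      push_cast
      rw [one_div, inv_mul_cancel₀ hQ0.ne', one_smul]
    have hzE : emb zz = q0 x0 + ∑ x ∈ X0, mu x • (q0 x - q0 x0) := by
      simp only [zz]
      rw [emb_add, emb_sum]
      have e1 : emb z0 = q0 x0 + ∑ x ∈ X0, γ x • (q0 x - q0 x0) := by
        simp only [smul_sub, Finset.sum_sub_distrib, hγ1, ← Finset.sum_smul, hγ0]
        simp
      rw [e1, add_assoc, ← Finset.sum_add_distrib]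
      congr 1
      refine Finset.sum_congr rfl fun x hx => ?_
      rw [emb_smul, hwE x hx, smul_smul, ← add_smul]
      congr 1
      simp only [mu]
      push_cast
      ring
    have hL : ∑ x ∈ X0, lam x • q0 x = q0 x0 + ∑ x ∈ X0, lam x • (q0 x - q0 x0) := by
      simp only [smul_sub, Finset.sum_sub_distrib, ← Finset.sum_smul, hlamsum]
      simp
    rw [hL, hzE, ← Finset.add_sum_erase _ _ hx0, ← Finset.add_sum_erase _ (fun x => mu x • _) hx0,
      sub_self, smul_zero, smul_zero]
    congr 2
    exact Finset.sum_congr rfl fun x hx => by rw [hlam_ne x hx]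
  have hcoord : ∀ i, ((zz i : ℤ) : ℝ) = ∑ x ∈ X0, lam x * ((x i : ℕ) : ℝ) := by
    intro i
    have := congrArg (fun v : EuclideanSpace ℝ (Fin d) => v i) hval
    simp [emb, q0, toZ] at this
    exact this.symm
  have hnn : ∀ i, 0 ≤ zz i := by
    intro i
    have : (0 : ℝ) ≤ zz i := by
      rw [hcoord]
      exact Finset.sum_nonneg fun x hx => mul_nonneg (hlampos x hx).le (Nat.cast_nonneg _)
    exact_mod_cast this
  have hlt : ∀ i, zz i < n := by
    intro i
    have : (zz i : ℝ) < (n : ℝ) := by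
      rw [hcoord, show (n : ℝ) = ∑ x ∈ X0, lam x * (n : ℝ) by
        rw [← Finset.sum_mul, hlamsum, one_mul]]
      refine Finset.sum_lt_sum_of_nonempty ⟨x0, hx0⟩ fun x hx => ?_
      have h1 : ((x i : ℕ) : ℝ) < n := by exact_mod_cast (x i).isLt
      exact mul_lt_mul_of_pos_left h1 (hlampos x hx)
    exact_mod_cast this
  let z : Pt d n := fun i => ⟨(zz i).toNat, by
    have h1 := hnn i; have h2 := hlt i; omega⟩
  have hz : toZ z = zz := by
    ext i
    simp only [toZ, z]
    exact Int.toNat_of_nonneg (hnn i)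
  refine ⟨z, ⟨lam, hlampos, hlamsum, ?_⟩, ?_⟩
  · rw [hval, q0, hz]
  · intro a
    rw [hz]
    simp only [zz]
    rw [TT_add, add_sub_cancel_left, TT_sum]
    refine Finset.dvd_sum fun x hx => ?_
    rw [TT_smul]
    have h1 : (Q : ℤ) * TT n (w x) = TT n (toZ x) - TT n (toZ x0) := by
      rw [← TT_smul, hw x hx, TT_sub]
    have h2 := hM a x hx
    rw [← h1] at h2
    have h3 : IsCoprime (M a : ℤ) (Q : ℤ) := Nat.isCoprime_iff_coprime.mpr (hcop a).symm
    have h4 : (M a : ℤ) ∣ D * TT n (w x) := by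
      have h5 : (M a : ℤ) ∣ (Q : ℤ) * (D * TT n (w x)) := by
        rw [mul_left_comm]; exact h2
      exact h3.dvd_of_dvd_mul_left h5
    rw [mul_assoc]
    exact Dvd.dvd.mul_left h4 _

lemma robust {d n : ℕ} (X : Finset (Pt d n)) (f : ℕ → ℕ) (hf0 : 2 ≤ f 0) (hX : f d ≤ X.card) :
    ∃ j, ∃ Y ⊆ X, f (j + 1) ≤ Y.card ∧ ∀ S ⊆ Y, f j ≤ S.card →
      dirSub Y (q0 : Pt d n → _) ≤ dirSub S (q0 : Pt d n → _) := by
  classical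
  have hex : ∃ j, ∃ Y ⊆ X, f j ≤ Y.card ∧
      Module.finrank ℝ (dirSub Y (q0 : Pt d n → _)) ≤ j := by
    refine ⟨d, X, subset_rfl, hX, ?_⟩
    refine (Submodule.finrank_le _).trans ?_
    simp
  obtain ⟨Y, hYX, hYc, hYr⟩ := Nat.find_spec hex
  have hmin := fun m => @Nat.find_min _ _ hex m
  generalize Nat.find hex = k at *
  cases k with
  | zero =>
    exfalso
    obtain ⟨x, hx, y, hy, hxy⟩ := Finset.one_lt_card.mp (show 1 < Y.card by omega)
    have h0 : dirSub Y (q0 : Pt d n → _) = ⊥ := Submodule.finrank_eq_zero.mp (by omega)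
    have h1 := sub_mem_dirSub (q0 : Pt d n → _) hx hy
    rw [h0, Submodule.mem_bot, sub_eq_zero] at h1
    apply hxy
    ext i
    have := congrArg (fun v : EuclideanSpace ℝ (Fin d) => v i) h1
    simp [q0, emb, toZ] at this
    exact this
  | succ j =>
    refine ⟨j, Y, hYX, hYc, fun S hS hSc => ?_⟩
    have h1 := hmin j (Nat.lt_succ_self j)
    push Not at h1
    have h2 := h1 S (hS.trans hYX) hSc
    exact (Submodule.eq_of_le_of_finrank_le (dirSub_mono hS _) (by omega)).ge

def Xs {d n : ℕ} (X0 : Finset (Pt d n)) (y : Fin d → Pt d n) (a : ℕ) : Finset (Pt d n) :=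
  X0 ∪ (univ.filter (fun b : Fin d => (b : ℕ) < a)).image y

def Config {d n : ℕ} (p : ℕ → ℕ) (X0 : Finset (Pt d n)) (y : Fin d → Pt d n) (z : Pt d n) :
    Prop :=
  (∃ lam : Pt d n → ℝ, (∀ x ∈ X0, 0 < lam x) ∧ ∑ x ∈ X0, lam x = 1 ∧
      ∑ x ∈ X0, lam x • q0 x = q0 z) ∧
  (∀ b, ∀ x ∈ X0, q0 (y b) - q0 x ∈ dirSub X0 (q0 : Pt d n → _)) ∧
  ∀ a : Fin d, StepOK (p a) (n ^ d) tau (Xs X0 y a) (y a) z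

lemma exists_config {d n : ℕ} (p : ℕ → ℕ) (hp : ∀ a, 2 ≤ p a)
    (hcop : ∀ a b, a ≠ b → Nat.Coprime (p a) (p b)) (f : ℕ → ℕ) (hf0 : 2 ≤ f 0)
    (hf2 : ∀ j, 2 ≤ f j)
    (hf : ∀ j, f (j + 1) = (f j * (∏ a ∈ range d, p a) + 1) ^ d * (f j * ∏ a ∈ range d, p a))
    (X : Finset (Pt d n)) (hX : f d ≤ X.card) :
    ∃ X0 y z, Config p X0 y z ∧ X0 ⊆ X ∧ ∀ b, y b ∈ X := by
  classical
  obtain ⟨j, Y, hYX, hYc, hYdir⟩ := robust X f hf0 hX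
  set s := f j with hs
  set D := ∏ a ∈ range d, p a with hD
  set Q := s * D + 1 with hQ
  have hDpos : 0 < D := Finset.prod_pos (fun a _ => by have := hp a; omega)
  rw [hf] at hYc
  have hQpos : 0 < Q := by omega
  obtain ⟨r, -, hr⟩ := Finset.exists_le_card_fiber_of_mul_le_card_of_maps_to
    (s := Y) (t := (univ : Finset (Fin d → Fin Q)))
    (f := fun x i => (⟨(x i : ℕ) % Q, Nat.mod_lt _ hQpos⟩ : Fin Q)) (n := s * D)
    (fun a _ => Finset.mem_univ _) ⟨fun _ => ⟨0, hQpos⟩, Finset.mem_univ _⟩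
    (by simpa using hYc)
  set Y1 := Y.filter (fun x => (fun i => (⟨(x i : ℕ) % Q, Nat.mod_lt _ hQpos⟩ : Fin Q)) = r)
    with hY1
  have hY1Y : Y1 ⊆ Y := Finset.filter_subset _ _
  have hY1mod : ∀ x ∈ Y1, ∀ x' ∈ Y1, ∀ i, (Q : ℤ) ∣ toZ x i - toZ x' i := by
    intro x hx x' hx' i
    have h1 := congrFun (Finset.mem_filter.mp hx).2 i
    have h2 := congrFun (Finset.mem_filter.mp hx').2 i
    have h3 := congrArg Fin.val (h2.trans h1.symm)
    simp only at h3
    exact Nat.modEq_iff_dvd.mp h3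
  obtain ⟨X0, hX0Y1, hX0c, y', hy'Y, hch⟩ := chain (L := n ^ d) p hp (tau : Pt d n → ℕ) tau_lt
    tau_inj s (hf2 j) d Y1 hr
  set y : Fin d → Pt d n := fun b => y' b with hy
  have hyY : ∀ b, y b ∈ Y := fun b => hY1Y (hy'Y b b.isLt)
  have hX0Y : X0 ⊆ Y := hX0Y1.trans hY1Y
  have hdir : ∀ u ∈ Y, ∀ v ∈ Y, q0 u - q0 v ∈ dirSub X0 (q0 : Pt d n → _) := fun u hu v hv =>
    hYdir X0 hX0Y (by omega) (sub_mem_dirSub _ hu hv)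
  have hXsub : ∀ a : Fin d, ∀ x ∈ Xs X0 y a, x ∈ X0 ∪ (range a).image y' := by
    intro a x hx
    rcases Finset.mem_union.mp hx with h | h
    · exact Finset.mem_union_left _ h
    · obtain ⟨b, hb, rfl⟩ := Finset.mem_image.mp h
      exact Finset.mem_union_right _ (Finset.mem_image.mpr
        ⟨b, Finset.mem_range.mpr (Finset.mem_filter.mp hb).2, rfl⟩)
  have hXsY : ∀ a : Fin d, Xs X0 y a ⊆ Y := by
    intro a x hx
    rcases Finset.mem_union.mp hx with h | h
    · exact hX0Y h
    · obtain ⟨b, hb, rfl⟩ := Finset.mem_image.mp h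
      exact hyY b
  have hX0Xs : ∀ a : Fin d, X0 ⊆ Xs X0 y a := fun a => Finset.subset_union_left
  obtain ⟨x0, hx0, x1, hx1, hx01⟩ := Finset.one_lt_card.mp
    (show 1 < X0.card by have := hf2 j; omega)
  have hdata : ∀ a : Fin d, ∃ i i' c : ℕ, ∃ xs ∈ Xs X0 y a, i < i' ∧ i' < n ^ d ∧
      (∀ x ∈ Xs X0 y a, tau x ≡ tau (y a) [MOD p a ^ i]) ∧
      (∀ x ∈ Xs X0 y a, dig (p a) i (tau x) = c) ∧ dig (p a) i (tau (y a)) ≠ c ∧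
      (∀ x ∈ Xs X0 y a, tau x ≡ tau xs [MOD p a ^ i']) ∧
      (∀ x ∈ Xs X0 y a, 0 ≤ ((dig (p a) i (tau (y a)) : ℝ) - c) *
        ((dig (p a) i' (tau xs) : ℝ) - dig (p a) i' (tau x))) ∧
      ∃ x ∈ Xs X0 y a, 0 < ((dig (p a) i (tau (y a)) : ℝ) - c) *
        ((dig (p a) i' (tau xs) : ℝ) - dig (p a) i' (tau x)) := by
    intro a
    obtain ⟨i, hi, c, hic, hicy⟩ := hch a a.isLt
    obtain ⟨i', hi', hcong, u, hu, v, hv, huv⟩ := firstSplit (hp a) (tau : Pt d n → ℕ) tau_lt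
      (Xs X0 y a) (hX0Xs a hx0) (hX0Xs a hx1) (fun h => hx01 (tau_inj h))
    have hii : i < i' := by
      by_contra hcon
      apply huv
      have hu' := hic u (hXsub a u hu)
      have hv' := hic v (hXsub a v hv)
      have hmod : tau u ≡ tau v [MOD p a ^ (i + 1)] :=
        modEq_succ.mpr ⟨hu'.1.trans hv'.1.symm, hu'.2.trans hv'.2.symm⟩
      exact dig_eq_of_lt (by omega) hmod
    obtain ⟨xs, hxs, hmax⟩ := Finset.exists_max_image (Xs X0 y a)
      (fun x => ((dig (p a) i (tau (y a)) : ℝ) - c) * (dig (p a) i' (tau x) : ℝ))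
      ⟨x0, hX0Xs a hx0⟩
    refine ⟨i, i', c, xs, hxs, hii, hi', fun x hx => (hic x (hXsub a x hx)).1,
      fun x hx => (hic x (hXsub a x hx)).2, hicy, fun x hx => hcong x hx xs hxs, ?_, ?_⟩
    · intro x hx
      have := hmax x hx
      rw [mul_sub]; linarith
    · obtain ⟨x, hx, hxne⟩ : ∃ x ∈ Xs X0 y a, dig (p a) i' (tau x) ≠ dig (p a) i' (tau xs) := by
        by_contra! hcon
        exact huv ((hcon u hu).trans (hcon v hv).symm)
      refine ⟨x, hx, lt_of_le_of_ne (by have := hmax x hx; rw [mul_sub]; linarith) ?_⟩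
      symm
      refine mul_ne_zero ?_ ?_
      · rw [sub_ne_zero]; exact_mod_cast hicy
      · rw [sub_ne_zero]; exact_mod_cast hxne.symm
  choose i i' c xs hxs hii hi' h1 h2 h3 h4 h5 h6 using hdata
  set M : Fin d → ℕ := fun a => p a ^ (i' a + 1) with hM
  obtain ⟨e, he⟩ := crt M (fun a b hab => Nat.Coprime.pow _ _
    (hcop a b (fun h => hab (Fin.ext h))))
  set z0 : Fin d → ℤ := toZ x0 + ∑ a, e a • (toZ (xs a) - toZ x0) with hz0
  have hpD : ∀ a : Fin d, p a ∣ D := fun a =>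
    Finset.dvd_prod_of_mem p (Finset.mem_range.mpr a.isLt)
  obtain ⟨z, hzlam, hzM⟩ := exists_z X0 x0 hx0 Q D hDpos (by rw [hX0c]; omega)
    (fun x hx => hY1mod x (hX0Y1 hx) x0 (hX0Y1 hx0)) M
    (by
      intro a
      refine Nat.Coprime.pow_right _ ?_
      have : Nat.Coprime Q (s * D) := by
        rw [hQ]
        simp
      exact Nat.Coprime.coprime_dvd_right ((hpD a).mul_left s) this)
    (by
      intro a x hx
      have hd1 : (p a : ℤ) ∣ D := by exact_mod_cast hpD a
      have hd2 : ((p a ^ i' a : ℕ) : ℤ) ∣ TT n (toZ x) - TT n (toZ x0) := by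
        rw [← tau_TT, ← tau_TT]
        exact Nat.modEq_iff_dvd.mp
          ((h4 a x0 (hX0Xs a hx0)).trans (h4 a x (hX0Xs a hx)).symm)
      have := mul_dvd_mul hd1 hd2
      simp only [hM]
      rw [pow_succ']
      push_cast at this ⊢
      exact this) z0
    (by
      rw [hz0, emb_add, emb_sum]
      change q0 x0 + _ - q0 x0 ∈ _
      rw [add_sub_cancel_left]
      refine Submodule.sum_mem _ fun a _ => ?_
      rw [emb_smul, emb_sub]
      exact Submodule.smul_mem _ _ (hdir _ (hXsY a (hxs a)) _ (hX0Y hx0)))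
  have hzx : ∀ a : Fin d, tau z ≡ tau (xs a) [MOD p a ^ (i' a + 1)] := by
    intro a
    refine Nat.ModEq.symm (Nat.modEq_iff_dvd.mpr ?_)
    rw [tau_TT, tau_TT]
    have e1 : TT n z0 - TT n (toZ (xs a)) =
        ∑ b, (e b - if b = a then 1 else 0) * (TT n (toZ (xs b)) - TT n (toZ x0)) := by
      rw [hz0, TT_add, TT_sum]
      simp only [TT_smul, TT_sub, sub_mul, Finset.sum_sub_distrib, ite_mul, one_mul, zero_mul,
        Finset.sum_ite_eq', Finset.mem_univ, if_true]
      ring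
    have e2 : (M a : ℤ) ∣ TT n z0 - TT n (toZ (xs a)) := by
      rw [e1]
      exact Finset.dvd_sum fun b _ => Dvd.dvd.mul_right (he b a) _
    have := dvd_add (hzM a) e2
    rw [sub_add_sub_cancel] at this
    exact this
  refine ⟨X0, y, z, ⟨hzlam, fun b x hx => hdir _ (hyY b) _ (hX0Y hx), fun a => ?_⟩,
    hX0Y.trans hYX, fun b => hYX (hyY b)⟩
  have hz1 := modEq_succ.mp (hzx a)
  refine ⟨i a, i' a, c a, hii a, hi' a, h1 a, h2 a, h3 a,
    fun x hx => (h4 a x hx).trans hz1.1.symm, ?_, ?_⟩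
  · rw [hz1.2]; exact h5 a
  · rw [hz1.2]; exact h6 a

def Good {d n : ℕ} (p : ℕ → ℕ) (a : ℕ) (q : Pt d n → EuclideanSpace ℝ (Fin d)) : Prop :=
  ∀ X0 y z, Config p X0 y z →
    (∃ lam : Pt d n → ℝ, (∀ x ∈ Xs X0 y a, 0 < lam x) ∧ ∑ x ∈ Xs X0 y a, lam x = 1 ∧
      ∑ x ∈ Xs X0 y a, lam x • q x = q z) ∧
    (∀ b : Fin d, (b : ℕ) < a → EuclideanSpace.single b (1 : ℝ) ∈ dirSub (Xs X0 y a) q) ∧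
    (∀ b, ∀ x ∈ X0, q (y b) - q x ∈ dirSub (Xs X0 y a) q)

lemma Xs_succ {d n : ℕ} (X0 : Finset (Pt d n)) (y : Fin d → Pt d n) (a : Fin d) :
    Xs X0 y (a + 1) = insert (y a) (Xs X0 y a) := by
  ext x
  simp only [Xs, Finset.mem_union, Finset.mem_image, Finset.mem_filter, Finset.mem_univ, true_and,
    Finset.mem_insert]
  constructor
  · rintro (h | ⟨b, hb, rfl⟩)
    · exact Or.inr (Or.inl h)
    · rcases Nat.lt_succ_iff_lt_or_eq.mp hb with h | h
      · exact Or.inr (Or.inr ⟨b, h, rfl⟩)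
      · exact Or.inl (by rw [Fin.ext h])
  · rintro (rfl | h | ⟨b, hb, rfl⟩)
    · exact Or.inr ⟨a, by omega, rfl⟩
    · exact Or.inl h
    · exact Or.inr ⟨b, by omega, rfl⟩

lemma good_step {d n : ℕ} (p : ℕ → ℕ) (a : Fin d) (q : Pt d n → EuclideanSpace ℝ (Fin d))
    (hq : Good p a q) :
    ∀ᶠ ε in 𝓝[>] (0 : ℝ), Good p (a + 1)
      (fun x => q x + hor (p a) (n ^ d) ε (tau x) • EuclideanSpace.single a (1 : ℝ)) := by
  unfold Good
  rw [Filter.eventually_all]; intro X0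
  rw [Filter.eventually_all]; intro y
  rw [Filter.eventually_all]; intro z
  by_cases hc : Config p X0 y z
  swap
  · exact Filter.Eventually.of_forall fun _ h => absurd h hc
  obtain ⟨⟨lam, hlp, hl1, hlz⟩, hdirs, hys⟩ := hq X0 y z hc
  have hok := hc.2.2 a
  have hyS : y a ∉ Xs X0 y a := by
    obtain ⟨i, i', c, -, -, -, h2, h3, -⟩ := hok
    exact fun h => h3 (h2 _ h)
  have hX0S : X0 ⊆ Xs X0 y a := Finset.subset_union_left
  obtain ⟨x0, hx0⟩ : X0.Nonempty := by
    obtain ⟨l, -, h, -⟩ := hc.1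
    by_contra hne
    rw [Finset.not_nonempty_iff_eq_empty.mp hne] at h
    simp at h
  obtain ⟨γ, hγ0, hγ1⟩ := hys a x0 hx0
  set bet : Pt d n → ℝ := fun x => γ x + if x = x0 then 1 else 0 with hbet
  have hb1 : ∑ x ∈ Xs X0 y a, bet x = 1 := by
    simp [hbet, Finset.sum_add_distrib, hγ0, hX0S hx0]
  have hby : ∑ x ∈ Xs X0 y a, bet x • q x = q (y a) := by
    simp [hbet, add_smul, Finset.sum_add_distrib, hγ1, hX0S hx0]
  filter_upwards [stepOK_ev hok lam bet hlp hl1 hb1] with ε hε _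
  obtain ⟨hne, mu, hmu0, hmu, hpos⟩ := hε
  obtain ⟨r1, r2, r3⟩ := step (Xs X0 y a) (y a) z hyS q (EuclideanSpace.single a (1 : ℝ))
    (fun x => hor (p a) (n ^ d) ε (tau x)) lam bet mu hl1 hlz hb1 hby hmu hpos hmu0 hne
  rw [Xs_succ]
  refine ⟨r1, ?_, ?_⟩
  · intro b hb
    rcases Nat.lt_succ_iff_lt_or_eq.mp hb with h | h
    · exact r3 (hdirs b h)
    · rw [Fin.ext h]; exact r2
  · intro b x hx
    have h1 := r3 (hys b x hx)
    have h2 := Submodule.smul_mem _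
      (hor (p a) (n ^ d) ε (tau (y b)) - hor (p a) (n ^ d) ε (tau x)) r2
    have h3 := Submodule.add_mem _ h1 h2
    convert h3 using 1
    module

lemma hor_zero (p L t : ℕ) : Tendsto (fun ε : ℝ => hor p L ε t) (𝓝[>] 0) (𝓝 0) := by
  have hc : Continuous (fun ε : ℝ => hor p L ε t) := by unfold hor; fun_prop
  have h := hc.tendsto 0
  have h0 : hor p L 0 t = 0 := by simp [hor]
  rw [h0] at h
  exact h.mono_left nhdsWithin_le_nhds

lemma exists_good {d n : ℕ} (p : ℕ → ℕ) (δ : ℝ) (hδ : 0 < δ) :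
    ∀ a ≤ d, ∃ q : Pt d n → EuclideanSpace ℝ (Fin d), Good p a q ∧ ∀ x, ‖q x - q0 x‖ ≤ a * δ := by
  intro a
  induction a with
  | zero =>
    intro _
    refine ⟨q0, ?_, by simp⟩
    intro X0 y z hc
    have : Xs X0 y 0 = X0 := by simp [Xs]
    rw [this]
    exact ⟨hc.1, by simp, hc.2.1⟩
  | succ a ih =>
    intro ha
    obtain ⟨q, hq, hqn⟩ := ih (by omega)
    have h1 := good_step p ⟨a, ha⟩ q hq
    have h2 : ∀ᶠ ε in 𝓝[>] (0 : ℝ), ∀ x : Pt d n, |hor (p a) (n ^ d) ε (tau x)| ≤ δ := by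
      rw [Filter.eventually_all]
      intro x
      have h := (hor_zero (p a) (n ^ d) (tau x)).abs
      rw [abs_zero] at h
      exact (h.eventually (gt_mem_nhds hδ)).mono fun _ h => le_of_lt h
    obtain ⟨ε, e1, e2⟩ := (h1.and h2).exists
    refine ⟨_, e1, fun x => ?_⟩
    have e3 : ‖hor (p a) (n ^ d) ε (tau x) •
        (EuclideanSpace.single ⟨a, ha⟩ (1 : ℝ) : EuclideanSpace ℝ (Fin d))‖ ≤ δ := by
      rw [norm_smul]
      simpa using e2 x
    calc _ = ‖(q x - q0 x) + hor (p a) (n ^ d) ε (tau x) •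
        (EuclideanSpace.single ⟨a, ha⟩ (1 : ℝ) : EuclideanSpace ℝ (Fin d))‖ := by
          congr 1; abel
      _ ≤ a * δ + δ := (norm_add_le _ _).trans (add_le_add (hqn x) e3)
      _ = _ := by push_cast; ring

lemma q0_dist_ge {d n : ℕ} {x y : Pt d n} (h : x ≠ y) : 1 ≤ ‖q0 x - q0 y‖ := by
  obtain ⟨i, hi⟩ := Function.ne_iff.mp h
  have h1 : ‖(q0 x - q0 y) i‖ ≤ ‖q0 x - q0 y‖ := PiLp.norm_apply_le _ i
  refine le_trans ?_ h1
  have h2 : (toZ x i - toZ y i) ≠ 0 := by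
    intro h0
    apply hi
    ext
    simp only [toZ] at h0
    omega
  have h3 : (1 : ℤ) ≤ |toZ x i - toZ y i| := Int.one_le_abs h2
  have h4 : (q0 x - q0 y) i = ((toZ x i - toZ y i : ℤ) : ℝ) := by simp [q0, emb]
  rw [h4, Real.norm_eq_abs]
  exact_mod_cast h3

lemma q0_dist_le {d n : ℕ} (x y : Pt d n) : ‖q0 x - q0 y‖ ≤ d * n := by
  have h1 : q0 x - q0 y = ∑ i, EuclideanSpace.single i ((q0 x - q0 y) i) := by
    ext j
    simp [Finset.sum_apply]
  rw [h1]
  refine (norm_sum_le _ _).trans ?_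
  have h2 : ∀ i ∈ (univ : Finset (Fin d)),
      ‖EuclideanSpace.single i ((q0 x - q0 y) i)‖ ≤ (n : ℝ) := by
    intro i _
    have h4 : (q0 x - q0 y) i = ((x i : ℕ) : ℝ) - ((y i : ℕ) : ℝ) := by simp [q0, emb, toZ]
    rw [EuclideanSpace.norm_single, h4, Real.norm_eq_abs, abs_le]
    have hx : ((x i : ℕ) : ℝ) ≤ n := by exact_mod_cast (x i).isLt.le
    have hy : ((y i : ℕ) : ℝ) ≤ n := by exact_mod_cast (y i).isLt.le
    have hx0 : (0 : ℝ) ≤ ((x i : ℕ) : ℝ) := Nat.cast_nonneg _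
    have hy0 : (0 : ℝ) ≤ ((y i : ℕ) : ℝ) := Nat.cast_nonneg _
    constructor <;> linarith
  refine (Finset.sum_le_sum h2).trans ?_
  simp

lemma holeFree_remove {d C : ℕ} (hd : 2 ≤ d) {S : Set (EuclideanSpace ℝ (Fin d))} (hS : S.Finite)
    (hne : S.Nonempty) (h : HoleFree C S) : ∃ v ∈ S, HoleFree C (S \ {v}) := by
  obtain ⟨v, hv, hmax⟩ := Set.exists_max_image S (fun x => ‖x‖) hS hne
  refine ⟨v, hv, fun T hT hTf hTc => ?_⟩
  obtain ⟨s, hs, hsi⟩ := h T (hT.trans Set.diff_subset) hTf hTc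
  refine ⟨s, ⟨hs, ?_⟩, hsi⟩
  rintro rfl
  haveI : Nonempty (Fin d) := ⟨⟨0, by omega⟩⟩
  have h1 : convexHull ℝ T ⊆ Metric.closedBall 0 ‖s‖ := by
    refine convexHull_min (fun x hx => ?_) (convex_closedBall _ _)
    simpa using hmax x (hT hx).1
  have h2 := interior_mono h1 hsi
  rw [interior_closedBall'] at h2
  simp at h2

lemma holeFree_cut {d C : ℕ} (hd : 2 ≤ d) (k : ℕ) : ∀ (m : ℕ) (S : Set (EuclideanSpace ℝ (Fin d))),
    S.Finite → S.ncard = k + m → HoleFree C S → ∃ P ⊆ S, P.ncard = k ∧ HoleFree C P := by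
  intro m
  induction m with
  | zero => intro S _ hc h; exact ⟨S, subset_rfl, hc, h⟩
  | succ m ih =>
    intro S hS hc h
    have hne : S.Nonempty := by
      rw [← Set.ncard_pos hS]; omega
    obtain ⟨v, hv, hv2⟩ := holeFree_remove hd hS hne h
    have h1 : (S \ {v}).ncard = k + m := by
      rw [Set.ncard_diff_singleton_of_mem hv, hc]; rfl
    obtain ⟨P, hP, hPc, hPh⟩ := ih _ (hS.subset Set.diff_subset) h1 hv2
    exact ⟨P, hP.trans Set.diff_subset, hPc, hPh⟩

lemma spread_le {d : ℕ} {P : Set (EuclideanSpace ℝ (Fin d))} (hc : 2 ≤ P.ncard) {A B : ℝ}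
    (hA : 0 < A) (hB : 0 ≤ B) (h1 : ∀ x ∈ P, ∀ y ∈ P, x ≠ y → A ≤ dist x y)
    (h2 : ∀ x ∈ P, ∀ y ∈ P, x ≠ y → dist x y ≤ B) : spread P ≤ B / A := by
  have hPf : P.Finite := Set.finite_of_ncard_pos (by omega)
  obtain ⟨x, y, hx, hy, hxy⟩ := (Set.one_lt_ncard_iff hPf).mp (by omega : 1 < P.ncard)
  have hne : {c : ℝ | ∃ x ∈ P, ∃ y ∈ P, x ≠ y ∧ c = dist x y}.Nonempty :=
    ⟨_, x, hx, y, hy, hxy, rfl⟩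
  unfold spread
  refine div_le_div₀ hB (csSup_le hne ?_) hA (le_csInf hne ?_)
  · rintro _ ⟨x, hx, y, hy, hxy, rfl⟩; exact h2 x hx y hy hxy
  · rintro _ ⟨x, hx, y, hy, hxy, rfl⟩; exact h1 x hx y hy hxy

def ff (d D : ℕ) : ℕ → ℕ
  | 0 => 2
  | j + 1 => (ff d D j * D + 1) ^ d * (ff d D j * D)

lemma two_le_ff (d D : ℕ) (hD : 0 < D) : ∀ j, 2 ≤ ff d D j
  | 0 => le_rfl
  | j + 1 => by
    have h := two_le_ff d D hD j
    have h1 : 2 ≤ ff d D j * D := by nlinarith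
    have h2 : 0 < (ff d D j * D + 1) ^ d := by positivity
    rw [ff]
    nlinarith

lemma holeFree_range {d n C : ℕ} (p : ℕ → ℕ) (q : Pt d n → EuclideanSpace ℝ (Fin d))
    (hq : Function.Injective q) (hg : Good p d q)
    (hC : ∀ X : Finset (Pt d n), C ≤ X.card →
      ∃ X0 y z, Config p X0 y z ∧ X0 ⊆ X ∧ ∀ b, y b ∈ X) : HoleFree C (Set.range q) := by
  classical
  intro T hT hTf hTc
  set X : Finset (Pt d n) := univ.filter (fun x => q x ∈ T) with hX
  have hXT : q '' (X : Set (Pt d n)) = T := by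
    ext v
    constructor
    · rintro ⟨x, hx, rfl⟩
      simpa [hX] using hx
    · intro hv
      obtain ⟨x, rfl⟩ := hT hv
      exact ⟨x, by simpa [hX] using hv, rfl⟩
  have hXc : X.card = C := by
    rw [← hTc, ← hXT, Set.ncard_image_of_injective _ hq, Set.ncard_coe_finset]
  obtain ⟨X0, y, z, hconf, hX0, hy⟩ := hC X hXc.ge
  obtain ⟨⟨lam, hl0, hl1, hlz⟩, hs, -⟩ := hg X0 y z hconf
  refine ⟨q z, ⟨z, rfl⟩, ?_⟩
  have h1 := interior_of_pos (Xs X0 y d) q lam hl0 hl1 (fun b => hs b b.isLt)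
  rw [hlz] at h1
  refine interior_mono (convexHull_mono ?_) h1
  rw [← hXT]
  refine Set.image_mono ?_
  intro x hx
  simp only [Xs, Finset.coe_union, Set.mem_union, Finset.mem_coe, Finset.mem_image] at hx
  rcases hx with hx | ⟨b, -, rfl⟩
  · exact hX0 hx
  · exact hy b

end HF

theorem statement14 (d : ℕ) (hd : 2 ≤ d) :
    ∃ α : ℝ, 0 < α ∧ ∃ C : ℕ, ∀ k : ℕ, 2 ≤ k →
      ∃ P : Set (EuclideanSpace ℝ (Fin d)), P.Finite ∧ P.ncard = k ∧
        spread P ≤ α * (k : ℝ) ^ ((1 : ℝ) / d) ∧ HoleFree C P := by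
  classical
  set p : ℕ → ℕ := Nat.nth Nat.Prime with hpdef
  have hpr : ∀ a, (p a).Prime := fun a => Nat.prime_nth_prime a
  have hp : ∀ a, 2 ≤ p a := fun a => (hpr a).two_le
  have hcop : ∀ a b, a ≠ b → Nat.Coprime (p a) (p b) := by
    intro a b hab
    rw [Nat.coprime_primes (hpr a) (hpr b)]
    exact fun h => hab (Nat.nth_injective Nat.infinite_setOf_prime h)
  set D := ∏ a ∈ Finset.range d, p a with hD
  have hDpos : 0 < D := Finset.prod_pos (fun a _ => (hpr a).pos)
  have hd0 : (0 : ℝ) < d := by exact_mod_cast (by omega : 0 < d)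
  refine ⟨4 * d + 1, by positivity, HF.ff d D d, fun k hk => ?_⟩
  set r : ℝ := (k : ℝ) ^ ((1 : ℝ) / d) with hr
  have hk1 : (1 : ℝ) ≤ k := by exact_mod_cast (by omega : 1 ≤ k)
  have hr1 : 1 ≤ r := Real.one_le_rpow hk1 (by positivity)
  set n := ⌈r⌉₊ with hn
  have hnr : r ≤ n := Nat.le_ceil r
  have hn2 : (n : ℝ) ≤ 2 * r := by
    have := Nat.ceil_lt_add_one (by linarith : 0 ≤ r)
    linarith
  have hkn : k ≤ n ^ d := by
    have h1 : r ^ d = (k : ℝ) := by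
      rw [hr, ← Real.rpow_natCast, ← Real.rpow_mul (by linarith), one_div,
        inv_mul_cancel₀ hd0.ne', Real.rpow_one]
    have h2 : r ^ d ≤ (n : ℝ) ^ d := pow_le_pow_left₀ (by linarith) hnr d
    rw [h1] at h2
    exact_mod_cast h2
  obtain ⟨q, hg, hq⟩ := HF.exists_good (d := d) (n := n) p (1 / (4 * d)) (by positivity) d le_rfl
  have hq4 : ∀ x, ‖q x - HF.q0 x‖ ≤ 1 / 4 := by
    intro x
    refine (hq x).trans (le_of_eq ?_)
    field_simp
  have hlow : ∀ x y, x ≠ y → 1 / 2 ≤ dist (q x) (q y) := by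
    intro x y hxy
    have h1 := HF.q0_dist_ge hxy
    have h2 : HF.q0 x - HF.q0 y = (q x - q y) - (q x - HF.q0 x) + (q y - HF.q0 y) := by abel
    have h3 : ‖HF.q0 x - HF.q0 y‖ ≤ ‖q x - q y‖ + ‖q x - HF.q0 x‖ + ‖q y - HF.q0 y‖ := by
      rw [h2]
      exact (norm_add_le _ _).trans (by gcongr; exact norm_sub_le _ _)
    rw [dist_eq_norm]
    linarith [hq4 x, hq4 y]
  have hup : ∀ x y, dist (q x) (q y) ≤ d * n + 1 / 2 := by
    intro x y
    have h1 := HF.q0_dist_le x y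
    have h2 : q x - q y = (HF.q0 x - HF.q0 y) + (q x - HF.q0 x) - (q y - HF.q0 y) := by abel
    have h3 : ‖q x - q y‖ ≤ ‖HF.q0 x - HF.q0 y‖ + ‖q x - HF.q0 x‖ + ‖q y - HF.q0 y‖ := by
      rw [h2]
      exact (norm_sub_le _ _).trans (by gcongr; exact norm_add_le _ _)
    rw [dist_eq_norm]
    linarith [hq4 x, hq4 y]
  have hinj : Function.Injective q := by
    intro x y hxy
    by_contra hne
    have := hlow x y hne
    rw [hxy, dist_self] at this
    norm_num at this
  have hHF : HoleFree (HF.ff d D d) (Set.range q) := by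
    refine HF.holeFree_range p q hinj hg fun X hX => ?_
    exact HF.exists_config p hp hcop (HF.ff d D) (HF.two_le_ff d D hDpos 0)
      (HF.two_le_ff d D hDpos) (fun j => rfl) X hX
  have hcard : (Set.range q).ncard = k + (n ^ d - k) := by
    rw [← Set.image_univ, Set.ncard_image_of_injective _ hinj, Set.ncard_univ, Nat.card_eq_fintype_card]
    simp
    omega
  obtain ⟨P, hPs, hPc, hPh⟩ := HF.holeFree_cut hd k _ _ (Set.finite_range q) hcard hHF
  refine ⟨P, (Set.finite_range q).subset hPs, hPc, ?_, hPh⟩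
  have hs : spread P ≤ (d * n + 1 / 2) / (1 / 2) := by
    refine HF.spread_le (by omega) (by norm_num) (by positivity) ?_ ?_
    · intro u hu v hv huv
      obtain ⟨x, rfl⟩ := hPs hu
      obtain ⟨y, rfl⟩ := hPs hv
      exact hlow x y (fun h => huv (by rw [h]))
    · intro u hu v hv _
      obtain ⟨x, rfl⟩ := hPs hu
      obtain ⟨y, rfl⟩ := hPs hv
      exact hup x y
  refine hs.trans ?_
  have h5 : (d : ℝ) * n ≤ d * (2 * r) := by gcongr
  have h6 : ((d : ℝ) * n + 1 / 2) / (1 / 2) = 2 * (d * n) + 1 := by ring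
  rw [h6]
  nlinarith
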